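/- For any prime p and positive integers k and n with n > 1 and such that Z_p semidirect_g Z_n exists nonabelian (ord_n(g) = p), the k-th Davenport constant satisfies d_k(Z_p semidirect Z_n) = nk + p - 1. -/

import Mathlib

open List Subgroup

/-- The set of all products of the terms of `S` in all orders. -/
def PiSet {G : Type*} [Group G] (S : List G) : Set G :=
  {g | ∃ l : List G, l.Perm S ∧ l.prod = g}

/-- `S` is a product-one sequence if `1 ∈ Π(S)`. -/
def IsProdOne {G : Type*} [Group G] (S : List G) : Prop :=
  (1 : G) ∈ PiSet S

/-- The Davenport constant `d(G)`: the smallest `m` such that every sequence of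
length `m` over `G` contains a nonempty product-one subsequence. -/
noncomputable def dC (G : Type*) [Group G] : ℕ :=
  sInf {m | 0 < m ∧ ∀ S : List G, S.length = m →
    ∃ T : List G, T ≠ [] ∧ T.Sublist S ∧ IsProdOne T}

/-- `e(G)`: the smallest `m` such that every nonempty product-one sequence over `G`
contains a nonempty product-one subsequence of length at most `m`. -/
noncomputable def eC (G : Type*) [Group G] : ℕ :=
  sInf {m | 0 < m ∧ ∀ S : List G, S ≠ [] → IsProdOne S →
    ∃ T : List G, T ≠ [] ∧ T.Sublist S ∧ T.length ≤ m ∧ IsProdOne T}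

/-- `f(G)`: the smallest `m` such that every sequence of length `d(G)` over `G`
contains a nonempty product-one subsequence of length at most `m`. -/
noncomputable def fC (G : Type*) [Group G] : ℕ :=
  sInf {m | 0 < m ∧ ∀ S : List G, S.length = dC G →
    ∃ T : List G, T ≠ [] ∧ T.Sublist S ∧ T.length ≤ m ∧ IsProdOne T}

/-- The `k`-th Davenport constant `d_k(G)`: the smallest `m` such that every sequence of
length `m` over `G` contains `k` pairwise disjoint nonempty product-one subsequences. -/
noncomputable def dkC (G : Type*) [Group G] (k : ℕ) : ℕ :=
  sInf {m | 0 < m ∧ ∀ S : List G, S.length = m →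
    ∃ Ts : List (List G), Ts.length = k ∧ (∀ T ∈ Ts, T ≠ [] ∧ IsProdOne T) ∧
      (Ts.flatten : Multiset G) ≤ (S : Multiset G)}


/-- A multiset has parts of every smaller cardinality. -/
lemma Multiset.exists_le_card_eq_of_le {α : Type*} {S : Multiset α} {n : ℕ} (h : n ≤ S.card) :
    ∃ T ≤ S, T.card = n := by
  induction S using Quotient.inductionOn with
  | h l =>
    refine ⟨(l.take n : Multiset α), Multiset.coe_le.2 (List.take_sublist n l).subperm, ?_⟩
    simpa using h

/-- A long enough list over a finite group, through a map `f`, contains a nonempty segment of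
bounded length with trivial product. -/
lemma exists_segment_prod_eq_one {α M : Type*} [Group M] [Finite M] (f : α → M) (l : List α)
    (h : Nat.card M ≤ l.length) :
    ∃ u v w : List α, l = u ++ v ++ w ∧ v ≠ [] ∧ v.length ≤ Nat.card M ∧ (v.map f).prod = 1 := by
  obtain ⟨i, j, hij, he⟩ : ∃ i j : Fin (Nat.card M + 1), i < j ∧
      ((l.take i).map f).prod = ((l.take j).map f).prod := by
    have : Fintype M := Fintype.ofFinite M
    obtain ⟨i, j, hne, he⟩ := Fintype.exists_ne_map_eq_of_card_lt
      (fun i : Fin (Nat.card M + 1) => ((l.take i).map f).prod)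
      (by simp)
    rcases lt_or_gt_of_ne hne with h | h
    · exact ⟨i, j, h, he⟩
    · exact ⟨j, i, h, he.symm⟩
  have hij' : (i : ℕ) < j := hij
  have hj : (j : ℕ) ≤ Nat.card M := Nat.lt_succ_iff.mp j.2
  have hsplit : l.take j = l.take i ++ (l.take j).drop i := by
    conv_lhs => rw [← List.take_append_drop i (l.take j)]
    rw [List.take_take, min_eq_left hij'.le]
  have hlen : ((l.take j).drop i).length = j - i := by
    simp [List.length_take, min_eq_left (hj.trans h)]
  refine ⟨l.take i, (l.take j).drop i, l.drop j, ?_, ?_, ?_, ?_⟩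
  · rw [← hsplit, List.take_append_drop]
  · intro h0
    rw [h0] at hlen
    simp at hlen
    omega
  · omega
  · rw [hsplit, List.map_append, List.prod_append] at he
    exact (left_eq_mul.mp he)

open MvPolynomial in
/-- More than `r (p - 1)` vectors in `(ℤ/p)^r` have a nonempty zero-sum subfamily. -/
lemma ZMod.exists_zero_sum_vectors {p : ℕ} [Fact p.Prime] {N r : ℕ} (a : Fin N → Fin r → ZMod p)
    (h : r * (p - 1) < N) :
    ∃ t : Finset (Fin N), t.Nonempty ∧ ∀ i, ∑ j ∈ t, a j i = 0 := by
  classical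
  let f : Fin r → MvPolynomial (Fin N) (ZMod p) := fun i => ∑ j, a j i • X j ^ (p - 1)
  have hp1 : p - 1 ≠ 0 := by have := (Fact.out : p.Prime).one_lt; omega
  have hdeg : ∑ i, (f i).totalDegree < Fintype.card (Fin N) := by
    have : ∑ i, (f i).totalDegree ≤ ∑ _i : Fin r, (p - 1) := by
      refine Finset.sum_le_sum fun i _ => ?_
      apply totalDegree_finsetSum_le
      intro j _
      exact (totalDegree_smul_le ..).trans (totalDegree_X_pow ..).le
    simp at this ⊢
    omega
  have hdvd : p ∣ Fintype.card {x : Fin N → ZMod p // ∀ i, eval x (f i) = 0} := by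
    convert char_dvd_card_solutions_of_fintype_sum_lt p hdeg
  let z : {x : Fin N → ZMod p // ∀ i, eval x (f i) = 0} :=
    ⟨0, by simp [f, map_sum, hp1]⟩
  have h0 : 0 < Fintype.card {x : Fin N → ZMod p // ∀ i, eval x (f i) = 0} :=
    Fintype.card_pos_iff.2 ⟨z⟩
  obtain ⟨x, hx⟩ := Fintype.exists_ne_of_one_lt_card
    ((Fact.out : p.Prime).one_lt.trans_le (Nat.le_of_dvd h0 hdvd)) z
  refine ⟨Finset.univ.filter fun j => x.1 j ≠ 0, ?_, fun i => ?_⟩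
  · rw [← Subtype.coe_ne_coe, Function.ne_iff] at hx
    obtain ⟨j, hj⟩ := hx
    exact ⟨j, Finset.mem_filter.2 ⟨Finset.mem_univ _, hj⟩⟩
  · have := x.2 i
    simpa [f, map_sum, ZMod.pow_card_sub_one, Finset.sum_filter] using this

/-- More than `r (p - 1)` terms with values in `(ℤ/p)^r` have a nonempty zero-sum part. -/
lemma ZMod.exists_zero_sum_le {p : ℕ} [Fact p.Prime] {α : Type*} {r : ℕ} (a : α → Fin r → ZMod p)
    (S : Multiset α) (h : r * (p - 1) < S.card) :
    ∃ T ≤ S, T ≠ 0 ∧ ∀ i, (T.map fun s => a s i).sum = 0 := by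
  induction S using Quotient.inductionOn with
  | h l =>
    simp only [Multiset.quot_mk_to_coe, Multiset.coe_card] at h ⊢
    obtain ⟨t, ⟨j, hj⟩, ht⟩ := ZMod.exists_zero_sum_vectors (fun j => a (l.get j)) h
    refine ⟨t.val.map l.get, ?_, ?_, fun i => ?_⟩
    · have h1 : t.val.map l.get ≤ Finset.univ.val.map l.get :=
        Multiset.map_le_map (Finset.val_le_iff.2 (Finset.subset_univ t))
      have h2 : Finset.univ.val.map l.get = (l : Multiset α) := by
        rw [Fin.univ_val_map, List.ofFn_get]
      rwa [h2] at h1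
    · intro h0
      simp only [Multiset.map_eq_zero, Finset.val_eq_zero] at h0
      simp [h0] at hj
    · rw [Multiset.map_map]
      exact ht i

/-- Among `3p - 2` elements of `(ℤ/p)²` there is a nonempty zero-sum part of at most `p` terms. -/
lemma ZMod.exists_short_zero_sum_le {p : ℕ} [Fact p.Prime] {α : Type*} (a : α → Fin 2 → ZMod p)
    (S : Multiset α) (h : 3 * p - 2 ≤ S.card) :
    ∃ T ≤ S, T ≠ 0 ∧ T.card ≤ p ∧ ∀ i, (T.map fun s => a s i).sum = 0 := by
  classical
  have hp := (Fact.out : p.Prime).two_le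
  obtain ⟨S', hS', hc⟩ := Multiset.exists_le_card_eq_of_le h
  obtain ⟨T, hT, hT0, hz⟩ := ZMod.exists_zero_sum_le (r := 3)
    (fun s => Fin.cons 1 (a s)) S' (by omega)
  have hTp : p ∣ T.card := by
    have := hz 0
    simpa [ZMod.natCast_eq_zero_iff] using this
  have hz' : ∀ i : Fin 2, (T.map fun s => a s i).sum = 0 := fun i => by
    simpa using hz i.succ
  by_cases hle : T.card ≤ p
  · exact ⟨T, hT.trans hS', hT0, hle, hz'⟩
  have hcT := Multiset.card_le_card hT
  have hcard : T.card = 2 * p := by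
    obtain ⟨c, hc'⟩ := hTp
    have h1 : c < 3 := by
      by_contra! h3
      have : p * 3 ≤ p * c := Nat.mul_le_mul_left p h3
      omega
    have : c ≠ 0 := by rintro rfl; omega
    have : c ≠ 1 := by rintro rfl; omega
    obtain rfl : c = 2 := by omega
    omega
  obtain ⟨T', hT', hc'⟩ := Multiset.exists_le_card_eq_of_le
    (show 2 * p - 1 ≤ T.card by omega)
  obtain ⟨U, hU, hU0, hUz⟩ := ZMod.exists_zero_sum_le a T' (by omega)
  have hUT := hU.trans hT'
  have hcU := Multiset.card_le_card hU
  by_cases hUp : U.card ≤ p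
  · exact ⟨U, hUT.trans (hT.trans hS'), hU0, hUp, hUz⟩
  · have hcs := Multiset.card_sub hUT
    refine ⟨T - U, (Multiset.sub_le_self _ _).trans (hT.trans hS'), ?_, by omega, fun i => ?_⟩
    · rw [← Multiset.card_pos]
      omega
    · have := hz' i
      rw [← Multiset.sub_add_cancel hUT, Multiset.map_add, Multiset.sum_add, hUz, add_zero] at this
      exact this

/-- Coordinates on a group that multiply as in `ℤ/q ⋊ ℤ/p`, with `ℤ/p` acting through the
weights `wt`. -/
structure AffineCoords (p q : ℕ) (G : Type*) [Group G] where
  cls : G → ZMod p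
  pos : G → ZMod q
  wt : ZMod p → ZMod q
  cls_mul : ∀ a b, cls (a * b) = cls a + cls b
  pos_mul : ∀ a b, pos (a * b) = pos a + wt (cls a) * pos b
  wt_zero : wt 0 = 1
  wt_add : ∀ s t, wt (s + t) = wt s * wt t

namespace AffineCoords

variable {p q : ℕ} {G : Type*} [Group G] (c : AffineCoords p q G)

lemma cls_one : c.cls 1 = 0 := by
  have := c.cls_mul 1 1
  rw [mul_one] at this
  simpa using this

lemma pos_one : c.pos 1 = 0 := by
  have := c.pos_mul 1 1
  rw [mul_one, c.cls_one, c.wt_zero, one_mul] at this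
  simpa using this

lemma cls_prod (l : List G) : c.cls l.prod = (l.map c.cls).sum := by
  induction l with
  | nil => simp [c.cls_one]
  | cons a l ih => simp [c.cls_mul, ih]

lemma cls_prod_eq (l : List G) : c.cls l.prod = ((l : Multiset G).map c.cls).sum := by
  simp [c.cls_prod]

lemma wt_mul_wt_neg (s : ZMod p) : c.wt s * c.wt (-s) = 1 := by
  rw [← c.wt_add, add_neg_cancel, c.wt_zero]

/-- The classes of the products of the initial segments of `l`. -/
def pref (l : List G) : Finset (ZMod p) :=
  (l.inits.map fun u => c.cls u.prod).toFinset

lemma mem_pref {l : List G} {s : ZMod p} :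
    s ∈ c.pref l ↔ ∃ u v, l = u ++ v ∧ c.cls u.prod = s := by
  simp only [pref, List.mem_toFinset, List.mem_map, List.mem_inits]
  constructor
  · rintro ⟨u, ⟨v, hv⟩, h⟩
    exact ⟨u, v, hv.symm, h⟩
  · rintro ⟨u, v, hv, h⟩
    exact ⟨u, ⟨v, hv.symm⟩, h⟩

lemma zero_mem_pref (l : List G) : (0 : ZMod p) ∈ c.pref l :=
  c.mem_pref.2 ⟨[], l, rfl, by simp [c.cls_one]⟩

lemma pos_insert {u v T : List G} (hT : c.cls T.prod = 0) :
    c.pos (u ++ T ++ v).prod = c.pos (u ++ v).prod + c.wt (c.cls u.prod) * c.pos T.prod := by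
  simp only [List.prod_append, c.pos_mul, c.cls_mul, hT, add_zero]
  ring

lemma pref_insert {u v T : List G} (hT : c.cls T.prod = 0) :
    c.pref (u ++ v) ⊆ c.pref (u ++ T ++ v) := by
  intro s hs
  obtain ⟨a, b, hab, rfl⟩ := c.mem_pref.1 hs
  rw [c.mem_pref]
  rcases List.append_eq_append_iff.1 hab with ⟨d, rfl, rfl⟩ | ⟨d, rfl, rfl⟩
  · exact ⟨u ++ T ++ d, b, by simp, by simp [c.cls_mul, hT]⟩
  · exact ⟨a, d ++ T ++ v, by simp, rfl⟩

lemma pos_rotate {a b : List G} (hT : c.cls (a ++ b).prod = 0) :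
    c.pos (b ++ a).prod = c.wt (-c.cls a.prod) * c.pos (a ++ b).prod := by
  simp only [List.prod_append, c.pos_mul, c.cls_mul] at hT ⊢
  have h := c.wt_mul_wt_neg (c.cls a.prod)
  rw [eq_neg_of_add_eq_zero_right hT]
  linear_combination (-c.pos b.prod) * h

/-- A nonempty list with product in class `0` but not in position `0`, whose proper initial
segments have distinct classes. -/
structure IsBlock (T : List G) : Prop where
  ne_nil : T ≠ []
  cls_eq : c.cls T.prod = 0
  pos_ne : c.pos T.prod ≠ 0
  length_le : T.length ≤ (c.pref T).card

/-- Every element of `X` is the position of the product of a nonempty list drawn from `U`, of length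
at most `n`, with product in class `0` and with initial segments in all classes from `P`. -/
def Reach (U : Multiset G) (n : ℕ) (P : Finset (ZMod p)) (X : Finset (ZMod q)) : Prop :=
  ∀ v ∈ X, ∃ l : List G, l ≠ [] ∧ (l : Multiset G) ≤ U ∧ l.length ≤ n ∧ c.cls l.prod = 0 ∧
    c.pos l.prod = v ∧ P ⊆ c.pref l

lemma exists_zero_of_zero_sum {R T₀ : Multiset G} {h : ℕ} (hT₀ : T₀ ≤ R) (hne : T₀ ≠ 0)
    (hz : (T₀.map c.cls).sum = 0) (hh : T₀.card ≤ h) :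
    ∃ l : List G, l ≠ [] ∧ (l : Multiset G) ≤ R ∧ c.cls l.prod = 0 ∧ l.length ≤ h ∧
      l.length ≤ (c.pref l).card := by
  classical
  have hex : ∃ n, ∃ T ≤ R, T ≠ 0 ∧ (T.map c.cls).sum = 0 ∧ T.card = n :=
    ⟨_, T₀, hT₀, hne, hz, rfl⟩
  obtain ⟨T, hT, hT0, hTz, hTc⟩ := Nat.find_spec hex
  have hmin : ∀ T' ≤ R, T' ≠ 0 → (T'.map c.cls).sum = 0 → T.card ≤ T'.card := fun T' h1 h2 h3 => by
    rw [hTc]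
    exact Nat.find_min' hex ⟨T', h1, h2, h3, rfl⟩
  obtain ⟨l, rfl⟩ := Quot.exists_rep T
  change (l : Multiset G) ≤ R at hT
  change (l : Multiset G) ≠ 0 at hT0
  change ((l : Multiset G).map c.cls).sum = 0 at hTz
  change ∀ T' ≤ R, T' ≠ 0 → (T'.map c.cls).sum = 0 → (l : Multiset G).card ≤ T'.card at hmin
  rw [Multiset.coe_card] at hmin
  refine ⟨l, by simpa using hT0, hT, by rw [c.cls_prod_eq, hTz], ?_, ?_⟩
  · exact (hmin T₀ hT₀ hne hz).trans hh
  · rw [← Finset.card_range l.length]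
    apply Finset.card_le_card_of_injOn (fun j => c.cls (l.take j).prod)
    · intro j _
      exact c.mem_pref.2 ⟨l.take j, l.drop j, (List.take_append_drop j l).symm, rfl⟩
    · have key : ∀ i j, i < j → j < l.length → c.cls (l.take i).prod ≠ c.cls (l.take j).prod := by
        intro i j hij hj he
        have hsplit : l.take j = l.take i ++ (l.take j).drop i := by
          conv_lhs => rw [← List.take_append_drop i (l.take j)]
          rw [List.take_take, min_eq_left hij.le]
        rw [hsplit, List.prod_append, c.cls_mul] at he
        have h0 : c.cls ((l.take j).drop i).prod = 0 := by simpa using he.symm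
        have hlen : ((l.take j).drop i).length = j - i := by
          simp [List.length_take, min_eq_left hj.le]
        have := hmin ((l.take j).drop i : List G)
          ((Multiset.coe_le.2
            ((List.drop_sublist _ _).trans (List.take_sublist _ _)).subperm).trans hT)
          (by
            intro h
            rw [Multiset.coe_eq_zero] at h
            rw [h] at hlen
            simp at hlen
            omega)
          (by rw [← c.cls_prod_eq, h0])
        rw [Multiset.coe_card, hlen] at this
        omega
      intro i hi j hj he
      simp only [Finset.coe_range, Set.mem_Iio] at hi hj
      rcases lt_trichotomy i j with h | h | h
      · exact absurd he (key i j h hj)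
      · exact h
      · exact absurd he.symm (key j i h hi)

lemma exists_blocks {R : Multiset G} {r h : ℕ}
    (hR : ∀ R' ≤ R, r ≤ R'.card →
      ∃ T : List G, c.IsBlock T ∧ (T : Multiset G) ≤ R' ∧ T.length ≤ h) :
    ∃ Ts : List (List G), (∀ T ∈ Ts, c.IsBlock T ∧ T.length ≤ h) ∧
      (Ts.flatten : Multiset G) ≤ R ∧ R.card < Ts.flatten.length + r := by
  classical
  induction hn : R.card using Nat.strong_induction_on generalizing R with
  | _ n ih =>
    by_cases hr : R.card < r
    · exact ⟨[], by simp, by simp, by simpa [← hn] using hr⟩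
    obtain ⟨T, hT, hTR, hTh⟩ := hR R le_rfl (not_lt.1 hr)
    have hpos := List.length_pos_of_ne_nil hT.ne_nil
    have hc := Multiset.card_sub hTR
    have hle := Multiset.card_le_card hTR
    rw [Multiset.coe_card] at hc hle
    obtain ⟨Ts, h1, h2, h3⟩ := ih (R - T).card (by omega) (R := R - T)
      (fun R' hR' => hR R' (hR'.trans (Multiset.sub_le_self _ _))) rfl
    refine ⟨T :: Ts, ?_, ?_, ?_⟩
    · simpa using ⟨⟨hT, hTh⟩, h1⟩
    · rw [List.flatten_cons, ← Multiset.coe_add, add_comm]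
      have := add_le_add h2 (le_refl (T : Multiset G))
      rwa [Multiset.sub_add_cancel hTR] at this
    · rw [List.flatten_cons, List.length_append]
      omega

variable [Fact q.Prime]

lemma wt_ne_zero (s : ZMod p) : c.wt s ≠ 0 := fun h => by
  have := c.wt_mul_wt_neg s
  rw [h, zero_mul] at this
  exact zero_ne_one this

variable [Fact p.Prime]

open scoped Pointwise in
lemma Reach.insert_block {U : Multiset G} {n : ℕ} {P : Finset (ZMod p)} {X : Finset (ZMod q)}
    (hX : c.Reach U n P X) (hwt : Function.Injective c.wt) (hXne : X.Nonempty) (hP : P.Nonempty)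
    {T : List G} (hT : c.IsBlock T) :
    ∃ X' : Finset (ZMod q), X'.Nonempty ∧ c.Reach (U + T) (n + T.length) P X' ∧
      min q (X.card + min p (P.card + T.length - 1)) ≤ X'.card := by
  classical
  let E : Finset (ZMod p) := P + (c.pref T).image (fun s => -s)
  let D : Finset (ZMod q) := E.image fun s => c.wt s * c.pos T.prod
  have hTne : (c.pref T).Nonempty := ⟨0, c.zero_mem_pref T⟩
  have hE : min p (P.card + T.length - 1) ≤ E.card := by
    have h1 := ZMod.cauchy_davenport (Fact.out : p.Prime) hP (hTne.image (fun s => -s))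
    have h2 : ((c.pref T).image (fun s => -s)).card = (c.pref T).card :=
      Finset.card_image_of_injective _ neg_injective
    have h3 := hT.length_le
    rw [h2] at h1
    refine le_trans ?_ h1
    exact min_le_min le_rfl (by omega)
  have hD : D.card = E.card := by
    apply Finset.card_image_of_injective
    intro s t hst
    exact hwt (mul_right_cancel₀ hT.pos_ne hst)
  have h0 : (0 : ZMod q) ∉ D := by
    intro h
    obtain ⟨s, -, hs⟩ := Finset.mem_image.1 h
    exact mul_ne_zero (c.wt_ne_zero s) hT.pos_ne hs
  refine ⟨X + insert 0 D, hXne.add (Finset.insert_nonempty _ _), ?_, ?_⟩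
  · intro v hv
    obtain ⟨x, hx, d, hd, rfl⟩ := Finset.mem_add.1 hv
    obtain ⟨l, hl0, hlU, hln, hlc, hlp, hPl⟩ := hX x hx
    rcases Finset.mem_insert.1 hd with rfl | hd
    · exact ⟨l, hl0, hlU.trans (Multiset.le_add_right _ _), by omega, hlc, by simpa using hlp, hPl⟩
    obtain ⟨s, hs, rfl⟩ := Finset.mem_image.1 hd
    obtain ⟨s₁, hs₁, s₂, hs₂, rfl⟩ := Finset.mem_add.1 hs
    obtain ⟨t, ht, rfl⟩ := Finset.mem_image.1 hs₂
    obtain ⟨u, v, rfl, rfl⟩ := c.mem_pref.1 (hPl hs₁)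
    obtain ⟨a, b, rfl, rfl⟩ := c.mem_pref.1 ht
    have hba : c.cls (b ++ a).prod = 0 := by
      have := hT.cls_eq
      rw [List.prod_append, c.cls_mul] at this ⊢
      rwa [add_comm]
    refine ⟨u ++ (b ++ a) ++ v, ?_, ?_, ?_, ?_, ?_, hPl.trans (c.pref_insert hba)⟩
    · have := hT.ne_nil
      simp only [ne_eq, List.append_eq_nil_iff] at this ⊢
      tauto
    · have h1 : ((u ++ (b ++ a) ++ v : List G) : Multiset G) =
          ((u ++ v : List G) : Multiset G) + ((a ++ b : List G) : Multiset G) := by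
        simp only [← Multiset.coe_add]
        abel
      rw [h1]
      exact add_le_add hlU le_rfl
    · simp only [List.length_append] at hln ⊢
      omega
    · simp only [List.prod_append, c.cls_mul] at hlc hba ⊢
      linear_combination hlc + hba
    · rw [c.pos_insert hba, c.pos_rotate hT.cls_eq, hlp, c.wt_add]
      ring
  · have h1 := ZMod.cauchy_davenport (Fact.out : q.Prime) hXne (Finset.insert_nonempty 0 D)
    rw [Finset.card_insert_of_notMem h0] at h1
    refine le_trans ?_ h1
    exact min_le_min le_rfl (by omega)

lemma Reach.insert_blocks {U : Multiset G} {n : ℕ} {P : Finset (ZMod p)} {X : Finset (ZMod q)}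
    (hX : c.Reach U n P X) (hwt : Function.Injective c.wt) (hXne : X.Nonempty) (hP : P.Nonempty)
    {Ts : List (List G)} (hTs : ∀ T ∈ Ts, c.IsBlock T) :
    ∃ X' : Finset (ZMod q), c.Reach (U + Ts.flatten) (n + Ts.flatten.length) P X' ∧
      min q (X.card + (Ts.map fun T => min p (P.card + T.length - 1)).sum) ≤ X'.card := by
  induction Ts generalizing U n X with
  | nil => exact ⟨X, by simpa using hX, by simp⟩
  | cons T Ts ih =>
    obtain ⟨X₁, hne, h1, h2⟩ := hX.insert_block c hwt hXne hP (hTs T (by simp))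
    obtain ⟨X₂, h3, h4⟩ := ih h1 hne (fun T' hT' => hTs T' (by simp [hT']))
    refine ⟨X₂, ?_, ?_⟩
    · simpa [← Multiset.coe_add, add_assoc] using h3
    · refine le_trans ?_ h4
      simp only [List.map_cons, List.sum_cons]
      omega

/-- A collection of blocks inserted into what is already reached gives a product in class and
position `0` as soon as the Cauchy–Davenport count reaches `q`. -/
lemma Reach.exists_trivial {U : Multiset G} {n : ℕ} {P : Finset (ZMod p)} {X : Finset (ZMod q)}
    (hX : c.Reach U n P X) (hwt : Function.Injective c.wt) (hXne : X.Nonempty) (hP : P.Nonempty)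
    {Ts : List (List G)} (hTs : ∀ T ∈ Ts, c.IsBlock T)
    (hq : q ≤ X.card + (Ts.map fun T => min p (P.card + T.length - 1)).sum) :
    ∃ l : List G, l ≠ [] ∧ (l : Multiset G) ≤ U + Ts.flatten ∧ l.length ≤ n + Ts.flatten.length ∧
      c.cls l.prod = 0 ∧ c.pos l.prod = 0 := by
  obtain ⟨X', h1, h2⟩ := hX.insert_blocks c hwt hXne hP hTs
  rw [min_eq_left hq] at h2
  have huniv : X' = Finset.univ :=
    Finset.eq_univ_of_card _ (le_antisymm (Finset.card_le_univ _) (by rwa [ZMod.card]))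
  obtain ⟨l, a1, a2, a3, a4, a5, -⟩ := h1 0 (by simp [huniv])
  exact ⟨l, a1, a2, a3, a4, a5⟩

end AffineCoords

/-- A submultiset of the image of a multiset is the image of a submultiset. -/
lemma Multiset.exists_le_map_eq {α β : Type*} {f : α → β} {R : Multiset α} {C : Multiset β}
    (h : C ≤ R.map f) : ∃ T ≤ R, T.map f = C := by
  induction R using Quotient.inductionOn with
  | h r =>
    induction C using Quotient.inductionOn with
    | h c =>
      obtain ⟨l, hl, hs⟩ : c.Subperm (r.map f) := Multiset.coe_le.1 h
      obtain ⟨t, ht, rfl⟩ := List.sublist_map_iff.1 hs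
      exact ⟨t, Multiset.coe_le.2 ht.subperm, Multiset.coe_eq_coe.2 hl⟩

namespace ZMod

variable {p : ℕ} [Fact p.Prime]

open scoped Pointwise in
lemma exists_short_sums {M : Multiset (ZMod p)} (h0 : 0 ∉ M) (hM : M ≠ 0) (h : ℕ) :
    ∃ X : Finset (ZMod p), X.Nonempty ∧ min p (∑ i, min (M.count i) (h + 1)) ≤ X.card ∧
      ∀ v ∈ X, ∃ C : Multiset (ZMod p), C ≠ 0 ∧ C.card ≤ h + 1 ∧
        (∀ i, C.count i ≤ min (M.count i) (h + 1)) ∧ C.sum = v := by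
  induction h with
  | zero =>
    refine ⟨M.toFinset, by simpa using hM, ?_,
      fun v hv => ⟨{v}, by simp, by simp, fun i => ?_, by simp⟩⟩
    · refine (min_le_right _ _).trans (le_of_eq ?_)
      rw [Finset.card_eq_sum_ones, ← Finset.sum_subset (Finset.subset_univ M.toFinset)]
      · refine Finset.sum_congr rfl fun i hi => ?_
        have := Multiset.one_le_count_iff_mem.2 (Multiset.mem_toFinset.1 hi)
        omega
      · intro i _ hi
        rw [Multiset.mem_toFinset] at hi
        simp [Multiset.count_eq_zero.2 hi]
    · rw [Multiset.count_singleton]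
      split_ifs with hi
      · have := Multiset.one_le_count_iff_mem.2 (Multiset.mem_toFinset.1 hv)
        rw [hi]
        omega
      · exact Nat.zero_le _
  | succ h ih =>
    obtain ⟨X, hX, hc, hv⟩ := ih
    let A : Finset (ZMod p) := Finset.univ.filter fun i => h + 2 ≤ M.count i
    have h0A : (0 : ZMod p) ∉ A := by
      simp [A, Multiset.count_eq_zero.2 h0]
    refine ⟨X + insert 0 A, hX.add (Finset.insert_nonempty _ _), ?_, ?_⟩
    · have h1 := ZMod.cauchy_davenport (Fact.out : p.Prime) hX (Finset.insert_nonempty 0 A)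
      rw [Finset.card_insert_of_notMem h0A] at h1
      have h2 : ∑ i, min (M.count i) (h + 1 + 1) = ∑ i, min (M.count i) (h + 1) + A.card := by
        rw [Finset.card_filter, ← Finset.sum_add_distrib]
        refine Finset.sum_congr rfl fun i _ => ?_
        split_ifs <;> omega
      refine le_trans ?_ h1
      omega
    · intro v hv'
      obtain ⟨x, hx, a, ha, rfl⟩ := Finset.mem_add.1 hv'
      obtain ⟨C, hC0, hCc, hCn, rfl⟩ := hv x hx
      rcases Finset.mem_insert.1 ha with rfl | ha
      · refine ⟨C, hC0, by omega, fun i => ?_, by simp⟩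
        have := hCn i
        omega
      · refine ⟨a ::ₘ C, Multiset.cons_ne_zero, by simpa using hCc, fun i => ?_, ?_⟩
        · have := hCn i
          rw [Multiset.count_cons]
          split_ifs with hi
          · subst hi
            have : h + 2 ≤ M.count i := by simpa [A] using ha
            omega
          · omega
        · rw [Multiset.sum_cons, add_comm]

/-- A multiset of nonzero residues that is rich enough after truncating its multiplicities at `h`
contains a nonempty zero-sum part with at most `h` terms. -/
lemma exists_truncated_zero_sum {M : Multiset (ZMod p)} (h0 : 0 ∉ M) {h : ℕ}
    (hs : p ≤ ∑ i, min (M.count i) h) : ∃ C ≤ M, C ≠ 0 ∧ C.card ≤ h ∧ C.sum = 0 := by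
  have hp := (Fact.out : p.Prime).pos
  have hM : M ≠ 0 := by
    rintro rfl
    simp at hs
    omega
  obtain _ | h := h
  · simp at hs
    omega
  obtain ⟨X, -, hc, hX⟩ := exists_short_sums h0 hM h
  rw [min_eq_left hs] at hc
  have huniv : X = Finset.univ :=
    Finset.eq_univ_of_card _ (le_antisymm (Finset.card_le_univ _) (by rwa [ZMod.card]))
  obtain ⟨C, hC0, hCc, hCn, hCs⟩ := hX 0 (by simp [huniv])
  exact ⟨C, Multiset.le_iff_count.2 fun i => (hCn i).trans (min_le_left _ _), hC0, hCc, hCs⟩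

lemma le_sum_min_count {M : Multiset (ZMod p)} {h : ℕ} (hp : p + 1 = 2 * h)
    (hM : ∀ i, M.count i ≤ 4 * h - 3) (hc : 5 * h - 4 ≤ M.card) :
    p ≤ ∑ i, min (M.count i) h := by
  have hp2 := (Fact.out : p.Prime).two_le
  have hsum : ∑ i, M.count i = M.card := Multiset.sum_count_eq_card fun _ _ => Finset.mem_univ _
  by_cases h1 : ∃ i, h ≤ M.count i
  · obtain ⟨i, hi⟩ := h1
    rw [← Finset.add_sum_erase _ _ (Finset.mem_univ i), min_eq_right hi]
    by_cases h2 : ∃ j ≠ i, h ≤ M.count j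
    · obtain ⟨j, hj, hjh⟩ := h2
      have := Finset.single_le_sum (f := fun i => min (M.count i) h) (fun _ _ => Nat.zero_le _)
        (Finset.mem_erase.2 ⟨hj, Finset.mem_univ j⟩)
      simp only [min_eq_right hjh] at this
      omega
    · push Not at h2
      have h3 : ∑ j ∈ Finset.univ.erase i, min (M.count j) h =
          ∑ j ∈ Finset.univ.erase i, M.count j :=
        Finset.sum_congr rfl fun j hj => min_eq_left (h2 j (Finset.ne_of_mem_erase hj)).le
      rw [← Finset.add_sum_erase _ _ (Finset.mem_univ i)] at hsum
      have := hM i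
      omega
  · push Not at h1
    have h3 : ∑ j, min (M.count j) h = ∑ j, M.count j :=
      Finset.sum_congr rfl fun j _ => min_eq_left (h1 j).le
    omega

end ZMod

/-- A sublist with total weight at most `q` that is everything or comes within `p` of `q`. -/
lemma List.exists_sublist_sum_le {α : Type*} (w : α → ℕ) {p : ℕ} (l : List α)
    (hl : ∀ a ∈ l, w a ≤ p) (q : ℕ) :
    ∃ u, u.Sublist l ∧ (u.map w).sum ≤ q ∧ (u = l ∨ q < (u.map w).sum + p) := by
  induction l generalizing q with
  | nil => exact ⟨[], by simp⟩
  | cons a l ih =>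
    by_cases ha : w a ≤ q
    · obtain ⟨u, h1, h2, h3⟩ := ih (fun b hb => hl b (by simp [hb])) (q - w a)
      refine ⟨a :: u, h1.cons_cons a, ?_, ?_⟩
      · simp only [List.map_cons, List.sum_cons]
        omega
      · rcases h3 with rfl | h3
        · exact Or.inl rfl
        · right
          simp only [List.map_cons, List.sum_cons]
          omega
    · refine ⟨[], by simp, by simp, Or.inr ?_⟩
      have := hl a (by simp)
      simp
      omega

/-- A sublist with total weight at least `a` that falls below `a` without its last entry. -/
lemma List.exists_sublist_le_sum {α : Type*} (w : α → ℕ) (l : List α) (a : ℕ)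
    (ha : a ≤ (l.map w).sum) :
    ∃ u, u.Sublist l ∧ a ≤ (u.map w).sum ∧
      (u = [] ∨ ∃ v b, u = v ++ [b] ∧ (v.map w).sum < a) := by
  induction l using List.reverseRecOn with
  | nil => exact ⟨[], by simp, ha, Or.inl rfl⟩
  | append_singleton l b ih =>
    by_cases h : a ≤ (l.map w).sum
    · obtain ⟨u, h1, h2⟩ := ih h
      exact ⟨u, h1.trans (List.sublist_append_left _ _), h2⟩
    · exact ⟨l ++ [b], List.Sublist.refl _, ha, Or.inr ⟨l, b, rfl, not_le.1 h⟩⟩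

namespace AffineCoords

variable {p q : ℕ} {G : Type*} [Group G] (c : AffineCoords p q G)

/-- `S` contains a nonempty list of length at most `n` with product in class and position `0`. -/
def HasTrivial (S : Multiset G) (n : ℕ) : Prop :=
  ∃ l : List G, l ≠ [] ∧ (l : Multiset G) ≤ S ∧ l.length ≤ n ∧ c.cls l.prod = 0 ∧ c.pos l.prod = 0

variable {c} in
lemma HasTrivial.mono {S S' : Multiset G} {n n' : ℕ} (h : c.HasTrivial S n) (hS : S ≤ S')
    (hn : n ≤ n') : c.HasTrivial S' n' := by
  obtain ⟨l, h1, h2, h3, h4⟩ := h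
  exact ⟨l, h1, h2.trans hS, h3.trans hn, h4⟩

lemma exists_block_of_zero_sum {R T₀ : Multiset G} {h : ℕ} (hR : ¬ c.HasTrivial R h)
    (hT₀ : T₀ ≤ R) (hne : T₀ ≠ 0) (hz : (T₀.map c.cls).sum = 0) (hh : T₀.card ≤ h) :
    ∃ T : List G, c.IsBlock T ∧ (T : Multiset G) ≤ R ∧ T.length ≤ h := by
  obtain ⟨l, h1, h2, h3, h4, h5⟩ := c.exists_zero_of_zero_sum hT₀ hne hz hh
  exact ⟨l, ⟨h1, h3, fun h0 => hR ⟨l, h1, h2, h4, h3, h0⟩, h5⟩, h2, h4⟩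

variable [Fact p.Prime]

lemma exists_block_of_card_ge {R : Multiset G} (hR : ¬ c.HasTrivial R p) (h : p ≤ R.card) :
    ∃ T : List G, c.IsBlock T ∧ (T : Multiset G) ≤ R ∧ T.length ≤ p := by
  have hp := (Fact.out : p.Prime).pos
  obtain ⟨R', hR', hc⟩ := Multiset.exists_le_card_eq_of_le h
  obtain ⟨T, hT, hT0, hz⟩ := ZMod.exists_zero_sum_le (r := 1) (fun s _ => c.cls s) R' (by omega)
  exact c.exists_block_of_zero_sum hR (hT.trans hR') hT0 (hz 0)
    ((Multiset.card_le_card hT).trans hc.le)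

variable [Fact q.Prime]

lemma IsBlock.reach_rotate {K : List G} (hK : c.IsBlock K) (hwt : Function.Injective c.wt) :
    ∃ X : Finset (ZMod q), X.Nonempty ∧ K.length ≤ X.card ∧ c.Reach K K.length {0} X := by
  refine ⟨(c.pref K).image fun s => c.wt (-s) * c.pos K.prod,
    Finset.Nonempty.image ⟨0, c.zero_mem_pref K⟩ _, ?_, ?_⟩
  · rw [Finset.card_image_of_injective]
    · exact hK.length_le
    · intro s t hst
      exact neg_injective (hwt (mul_right_cancel₀ hK.pos_ne hst))
  · intro v hv
    obtain ⟨s, hs, rfl⟩ := Finset.mem_image.1 hv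
    obtain ⟨a, b, rfl, rfl⟩ := c.mem_pref.1 hs
    have hperm : (b ++ a).Perm (a ++ b) := List.perm_append_comm
    refine ⟨b ++ a, ?_, (Multiset.coe_le.2 hperm.subperm), hperm.length_eq.le, ?_,
      c.pos_rotate hK.cls_eq, ?_⟩
    · intro h
      have := hperm.length_eq
      rw [h] at this
      exact hK.ne_nil (List.length_eq_zero_iff.1 this.symm)
    · have := hK.cls_eq
      rw [List.prod_append, c.cls_mul] at this ⊢
      rwa [add_comm]
    · simpa using c.zero_mem_pref _

/-- Blocks of total length at least `q` contain a product in class and position `0`. -/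
lemma hasTrivial_of_blocks (hwt : Function.Injective c.wt) {Ts : List (List G)}
    (hTs : ∀ T ∈ Ts, c.IsBlock T ∧ T.length ≤ p) (hq : q ≤ Ts.flatten.length) :
    c.HasTrivial Ts.flatten Ts.flatten.length := by
  have hq0 := (Fact.out : q.Prime).pos
  obtain _ | ⟨K, Ts⟩ := Ts
  · simp at hq
    omega
  obtain ⟨X, hX, hXc, hr⟩ := (hTs K (by simp)).1.reach_rotate c hwt
  have hsum : (Ts.map fun T => min p (({0} : Finset (ZMod p)).card + T.length - 1)).sum =
      Ts.flatten.length := by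
    rw [List.length_flatten]
    congr 1
    refine List.map_congr_left fun T hT => ?_
    have := (hTs T (by simp [hT])).2
    simp [this]
  obtain ⟨l, h1, h2, h3, h4, h5⟩ := hr.exists_trivial c hwt hX (Finset.singleton_nonempty _)
    (Ts := Ts) (fun T hT => (hTs T (by simp [hT])).1) (by
      rw [hsum]
      simp at hq
      simp
      omega)
  exact ⟨l, h1, by simpa [← Multiset.coe_add] using h2, by simpa using h3, h4, h5⟩

/-- Without a bound on the length, `q + p - 1` elements suffice. -/
lemma hasTrivial_of_injective (hwt : Function.Injective c.wt) {S : Multiset G}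
    (hS : q + p - 1 ≤ S.card) : c.HasTrivial S S.card := by
  by_contra hno
  have hp := (Fact.out : p.Prime).pos
  have hq := (Fact.out : q.Prime).pos
  obtain ⟨Ts, h1, h2, h3⟩ := c.exists_blocks (R := S) (r := p) (h := p) fun R' hR' hc =>
    c.exists_block_of_card_ge (fun h => hno (h.mono hR' (by omega))) hc
  have h4 := Multiset.card_le_card h2
  rw [Multiset.coe_card] at h4
  exact hno ((c.hasTrivial_of_blocks hwt h1 (by omega)).mono h2 h4)

end AffineCoords

namespace AffineCoords

variable {p q : ℕ} {G : Type*} [Group G] (c : AffineCoords p q G)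

lemma isBlock_singleton {R : Multiset G} {h : ℕ} (hR : ¬ c.HasTrivial R h) (hh : 0 < h) {a : G}
    (ha : a ∈ R) (hc : c.cls a = 0) : c.IsBlock [a] where
  ne_nil := by simp
  cls_eq := by simpa using hc
  pos_ne h0 := hR ⟨[a], by simp, by simpa using ha, by simpa using Nat.succ_le_of_lt hh,
    by simpa using hc, by simpa using h0⟩
  length_le := Finset.card_pos.2 ⟨0, c.zero_mem_pref _⟩

lemma pos_prod_of_const {i : ZMod p} {b : ZMod q} (l : List G)
    (hl : ∀ a ∈ l, c.cls a = i ∧ c.pos a = b) :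
    (c.wt i - 1) * c.pos l.prod = (c.wt i ^ l.length - 1) * b := by
  induction l with
  | nil => simp [c.pos_one]
  | cons a l ih =>
    have h := ih fun a ha => hl a (by simp [ha])
    obtain ⟨h1, h2⟩ := hl a (by simp)
    rw [List.prod_cons, c.pos_mul, h1, h2, List.length_cons, pow_succ]
    linear_combination (c.wt i) * h

lemma wt_nsmul (s : ZMod p) (m : ℕ) : c.wt (m • s) = c.wt s ^ m := by
  induction m with
  | zero => simp [c.wt_zero]
  | succ m ih => rw [succ_nsmul, c.wt_add, ih, pow_succ]

lemma cls_prod_of_const {i : ZMod p} (l : List G) (hl : ∀ a ∈ l, c.cls a = i) :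
    c.cls l.prod = l.length • i := by
  rw [c.cls_prod, List.map_congr_left hl]
  simp

variable [Fact q.Prime]

/-- Choosing one element from each pair of a list of pairs in a common class. -/
lemma exists_choices {i : ZMod p} (Q : List (G × G))
    (hQ : ∀ z ∈ Q, c.cls z.1 = i ∧ c.cls z.2 = i ∧ c.pos z.1 ≠ c.pos z.2) :
    ∃ X : Finset (ZMod q), X.Nonempty ∧ min q (Q.length + 1) ≤ X.card ∧
      ∀ v ∈ X, ∃ l : List G, l.length = Q.length ∧
        (l : Multiset G) ≤ (Q.map Prod.fst : Multiset G) + (Q.map Prod.snd : Multiset G) ∧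
        (∀ a ∈ l, c.cls a = i) ∧ c.pos l.prod = v := by
  classical
  induction Q with
  | nil => exact ⟨{0}, by simp, by simp, fun v hv => ⟨[], by simpa [c.pos_one, eq_comm] using hv⟩⟩
  | cons z Q ih =>
    obtain ⟨X, hX, hXc, hv⟩ := ih fun z hz => hQ z (by simp [hz])
    obtain ⟨h1, h2, h3⟩ := hQ z (by simp)
    let Y := X.image fun v => c.wt i * v
    have hY : Y.card = X.card :=
      Finset.card_image_of_injective _ (mul_right_injective₀ (c.wt_ne_zero i))
    have hcd := ZMod.cauchy_davenport (Fact.out : q.Prime) (s := {c.pos z.1, c.pos z.2}) (t := Y)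
      (by simp) (hX.image _)
    rw [Finset.card_pair h3, hY] at hcd
    refine ⟨_, (Finset.insert_nonempty _ _).add (hX.image _), le_trans ?_ hcd, ?_⟩
    · rw [List.length_cons]
      omega
    · intro v hv'
      obtain ⟨b, hb, d, hd, rfl⟩ := Finset.mem_add.1 hv'
      obtain ⟨x, hx, rfl⟩ := Finset.mem_image.1 hd
      obtain ⟨l, e1, e2, e3, rfl⟩ := hv x hx
      obtain ⟨a, ha, hai, rfl⟩ : ∃ a, (a = z.1 ∨ a = z.2) ∧ c.cls a = i ∧ c.pos a = b := by
        rcases Finset.mem_insert.1 hb with rfl | hb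
        · exact ⟨z.1, Or.inl rfl, h1, rfl⟩
        · exact ⟨z.2, Or.inr rfl, h2, (Finset.mem_singleton.1 hb).symm⟩
      refine ⟨a :: l, by simp [e1], ?_, by simpa [hai] using e3, ?_⟩
      · have e4 : ((z :: Q).map Prod.fst : Multiset G) + ((z :: Q).map Prod.snd : Multiset G) =
            {z.1} + {z.2} + ((Q.map Prod.fst : Multiset G) + (Q.map Prod.snd : Multiset G)) := by
          simp only [List.map_cons, ← Multiset.cons_coe, ← Multiset.singleton_add]
          abel
        rw [e4, ← Multiset.cons_coe, ← Multiset.singleton_add]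
        refine add_le_add ?_ e2
        rcases ha with rfl | rfl
        · exact Multiset.le_add_right _ _
        · exact Multiset.le_add_left _ _
      · rw [List.prod_cons, c.pos_mul, hai]

variable [Fact p.Prime]

lemma hasTrivial_of_const (hwt : Function.Injective c.wt) {i : ZMod p} (hi : i ≠ 0) {b : ZMod q}
    {l : List G} (hlen : l.length = p) (hl : ∀ a ∈ l, c.cls a = i ∧ c.pos a = b) :
    c.HasTrivial l p := by
  have hp := (Fact.out : p.Prime).pos
  refine ⟨l, ?_, le_rfl, hlen.le, ?_, ?_⟩
  · rintro rfl
    simp at hlen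
    omega
  · rw [c.cls_prod_of_const l fun a ha => (hl a ha).1, hlen]
    simp
  · have h := c.pos_prod_of_const l hl
    rw [hlen, ← c.wt_nsmul] at h
    simp only [nsmul_eq_mul, CharP.cast_eq_zero, zero_mul, c.wt_zero, sub_self, mul_eq_zero] at h
    refine h.resolve_left fun h1 => hi (hwt ?_)
    rw [c.wt_zero]
    exact sub_eq_zero.1 h1

/-- `2 p` elements in a common nonzero class, no `p` of which have a common position, split into
pairs with distinct positions. -/
lemma exists_pairs (hwt : Function.Injective c.wt) {R : Multiset G} (hR : ¬ c.HasTrivial R p)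
    {i : ZMod p} (hi : i ≠ 0) (hRi : ∀ a ∈ R, c.cls a = i) (hc : R.card = 2 * p) :
    ∃ Q : List (G × G), Q.length = p ∧
      (∀ z ∈ Q, c.cls z.1 = i ∧ c.cls z.2 = i ∧ c.pos z.1 ≠ c.pos z.2) ∧
      (Q.map Prod.fst : Multiset G) + (Q.map Prod.snd : Multiset G) = R := by
  classical
  have hp := (Fact.out : p.Prime).pos
  obtain ⟨l, rfl, hsort⟩ : ∃ l : List G, (l : Multiset G) = R ∧
      l.Pairwise fun a b => (c.pos a).val ≤ (c.pos b).val := by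
    let r : G → G → Prop := fun a b => (c.pos a).val ≤ (c.pos b).val
    have : Std.Total r := ⟨fun a b => le_total _ _⟩
    have : IsTrans G r := ⟨fun a b d h1 h2 => le_trans h1 h2⟩
    exact ⟨R.toList.insertionSort r, by
      rw [Multiset.coe_eq_coe.2 (List.perm_insertionSort r R.toList), Multiset.coe_toList],
      List.pairwise_insertionSort r _⟩
  rw [Multiset.coe_card] at hc
  have hl1 : (l.take p).length = p := by simp; omega
  have hl2 : (l.drop p).length = p := by simp; omega
  refine ⟨(l.take p).zip (l.drop p), by simp; omega, ?_, ?_⟩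
  · intro z hz
    obtain ⟨j, hj, rfl⟩ := List.mem_iff_getElem.1 hz
    have hj' : j < p := by simp at hj; omega
    simp only [List.getElem_zip, List.getElem_take, List.getElem_drop]
    refine ⟨hRi _ (by simp), hRi _ (by simp), fun he => hR ?_⟩
    have hmono : ∀ (a b : ℕ) (hb : b < l.length) (hab : a ≤ b),
        (c.pos l[a]).val ≤ (c.pos l[b]).val := by
      intro a b hb hab
      rcases hab.eq_or_lt with rfl | hab
      · exact le_rfl
      · exact List.pairwise_iff_getElem.1 hsort a b _ hb hab
    have hsub : (((l.drop j).take p : List G) : Multiset G) ≤ l :=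
      Multiset.coe_le.2 ((List.take_sublist _ _).trans (List.drop_sublist _ _)).subperm
    refine (c.hasTrivial_of_const hwt hi (b := c.pos l[j]) (l := (l.drop j).take p) ?_ ?_).mono
      hsub le_rfl
    · simp
      omega
    · intro a ha
      refine ⟨hRi _ (Multiset.mem_of_le hsub ha), ?_⟩
      obtain ⟨s, hs, rfl⟩ := List.mem_iff_getElem.1 ha
      have hs' : s < p := by simp at hs; omega
      simp only [List.getElem_take, List.getElem_drop]
      apply ZMod.val_injective q
      apply le_antisymm
      · rw [he]
        exact hmono _ _ _ (by omega)
      · exact hmono _ _ _ (by omega)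
  · rw [List.map_fst_zip (by omega), List.map_snd_zip (by omega), Multiset.coe_add,
      List.take_append_drop]

/-- Many elements in class `0` give a short product in class and position `0`. -/
lemma hasTrivial_of_many_zero (hwt : Function.Injective c.wt) {S : Multiset G} (hpq : p ≤ q)
    (hS : 2 * q + p - 1 ≤ S.card) (hm : p - 1 ≤ (S.filter fun a => c.cls a = 0).card) :
    c.HasTrivial S q := by
  classical
  by_contra hno
  have hp := (Fact.out : p.Prime).pos
  set Z := S.filter fun a => c.cls a = 0 with hZ
  set R := S.filter fun a => ¬ c.cls a = 0 with hR
  have hZR : Z + R = S := Multiset.filter_add_not _ S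
  have hcard : Z.card + R.card = S.card := by rw [← hZR, Multiset.card_add]
  have hRS : R ≤ S := Multiset.filter_le _ _
  obtain ⟨Ts, h1, h2, h3⟩ := c.exists_blocks (R := R) (r := p) (h := p) fun R' hR' hc =>
    c.exists_block_of_card_ge (fun h => hno (h.mono (hR'.trans hRS) hpq)) hc
  obtain ⟨Us, hUs, hUq, hU⟩ := List.exists_sublist_sum_le List.length Ts (fun T hT => (h1 T hT).2) q
  rw [← List.length_flatten] at hUq hU
  have hfill : q - Us.flatten.length ≤ Z.card := by
    rcases hU with rfl | hU <;> omega
  obtain ⟨Z', hZ', hZc⟩ := Multiset.exists_le_card_eq_of_le hfill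
  obtain ⟨z, rfl⟩ := Quot.exists_rep Z'
  change (z : Multiset G) ≤ Z at hZ'
  change z.length = _ at hZc
  have hflat : (z.map fun a => [a]).flatten = z := by
    rw [← List.flatMap_def, List.flatMap_singleton']
  have hUR : (Us.flatten : Multiset G) ≤ R :=
    le_trans (Multiset.coe_le.2 hUs.flatten.subperm) h2
  have hlen : (Us ++ z.map fun a => [a]).flatten.length = q := by
    rw [List.flatten_append, hflat, List.length_append]
    omega
  refine hno ((c.hasTrivial_of_blocks hwt (Ts := Us ++ z.map fun a => [a]) ?_ hlen.ge).mono ?_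
    hlen.le)
  · intro T hT
    rcases List.mem_append.1 hT with hT | hT
    · exact h1 T (hUs.subset hT)
    · obtain ⟨a, ha, rfl⟩ := List.mem_map.1 hT
      have haZ : a ∈ Z := Multiset.mem_of_le hZ' ha
      rw [hZ, Multiset.mem_filter] at haZ
      exact ⟨c.isBlock_singleton hno (by omega) haZ.1 haZ.2, hp⟩
  · rw [List.flatten_append, hflat, ← Multiset.coe_add, add_comm, ← hZR]
    exact add_le_add hZ' hUR

/-- Many elements in a common nonzero class give a short product in class and position `0`. -/
lemma hasTrivial_of_many_const (hwt : Function.Injective c.wt) {S : Multiset G} (hpq : p ∣ q - 1)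
    (hS : 2 * q + p - 1 ≤ S.card) {i : ZMod p} (hi : i ≠ 0)
    (hm : 2 * p ≤ (S.filter fun a => c.cls a = i).card) :
    c.HasTrivial S q := by
  classical
  by_contra hno
  have hp := (Fact.out : p.Prime).pos
  have hq := (Fact.out : q.Prime).two_le
  obtain ⟨J, hJ⟩ := hpq
  obtain _ | J := J
  · omega
  rw [Nat.mul_succ] at hJ
  have hpq : p ≤ q := by omega
  obtain ⟨R, hR, hRc⟩ := Multiset.exists_le_card_eq_of_le hm
  have hRi : ∀ a ∈ R, c.cls a = i := fun a ha =>
    (Multiset.mem_filter.1 (Multiset.mem_of_le hR ha)).2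
  have hRS : R ≤ S := hR.trans (Multiset.filter_le _ _)
  obtain ⟨Q, hQ1, hQ2, hQ3⟩ := c.exists_pairs hwt (fun h => hno (h.mono hRS hpq)) hi hRi hRc
  obtain ⟨X, hX, hXc, hXl⟩ := c.exists_choices Q hQ2
  rw [hQ1] at hXc
  simp only [hQ3, hQ1] at hXl
  have hreach : c.Reach R p Finset.univ X := by
    intro v hv
    obtain ⟨l, e1, e2, e3, e4⟩ := hXl v hv
    have hlen : l.length = p := e1
    refine ⟨l, ?_, e2, hlen.le, ?_, e4, ?_⟩
    · rintro rfl
      simp at hlen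
      omega
    · rw [c.cls_prod_of_const l e3, hlen]
      simp
    · intro s _
      refine c.mem_pref.2 ⟨l.take (s / i).val, l.drop (s / i).val,
        (List.take_append_drop _ l).symm, ?_⟩
      rw [c.cls_prod_of_const _ fun a ha => e3 a (List.mem_of_mem_take ha), List.length_take,
        min_eq_left (by rw [hlen]; exact (ZMod.val_lt _).le), nsmul_eq_mul, ZMod.natCast_zmod_val,
        div_mul_cancel₀ _ hi]
  have hSR := Multiset.card_sub hRS
  obtain ⟨Ts, h1, h2, h3⟩ := c.exists_blocks (R := S - R) (r := p) (h := p) fun R' hR' hc =>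
    c.exists_block_of_card_ge
      (fun h => hno (h.mono (hR'.trans (Multiset.sub_le_self _ _)) hpq)) hc
  have hlen : ∀ Us : List (List G), (∀ T ∈ Us, T.length ≤ p) →
      Us.flatten.length ≤ Us.length * p := by
    intro Us hUs
    rw [List.length_flatten]
    simpa using List.sum_le_card_nsmul (Us.map List.length) p (by simpa using hUs)
  have hJT : J ≤ Ts.length := by
    by_contra! hlt
    have h4 := hlen Ts fun T hT => (h1 T hT).2
    have h5 : (Ts.length + 1) * p ≤ J * p := Nat.mul_le_mul_right p hlt
    rw [add_mul, one_mul] at h5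
    rw [mul_comm] at hJ
    omega
  have hlen' := hlen (Ts.take J) fun T hT => (h1 T (List.mem_of_mem_take hT)).2
  rw [List.length_take, min_eq_left hJT] at hlen'
  have hsum : ((Ts.take J).map fun T =>
      min p ((Finset.univ : Finset (ZMod p)).card + T.length - 1)).sum = J * p := by
    rw [List.map_congr_left (g := fun _ => p)]
    · simp [hJT]
    · intro T hT
      have := List.length_pos_of_ne_nil (h1 T (List.mem_of_mem_take hT)).1.ne_nil
      rw [Finset.card_univ, ZMod.card]
      omega
  rw [mul_comm] at hJ
  obtain ⟨l, a1, a2, a3, a4⟩ := hreach.exists_trivial c hwt hX Finset.univ_nonempty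
    (Ts := Ts.take J) (fun T hT => (h1 T (List.mem_of_mem_take hT)).1) (by
      rw [hsum]
      omega)
  refine hno ⟨l, a1, a2.trans ?_, by omega, a4⟩
  have h6 : ((Ts.take J).flatten : Multiset G) ≤ S - R :=
    le_trans (Multiset.coe_le.2 (List.take_sublist _ _).flatten.subperm) h2
  have := add_le_add (le_refl R) h6
  rwa [add_comm R (S - R), Multiset.sub_add_cancel hRS] at this

end AffineCoords

/-- The numerical estimate behind `AffineCoords.hasTrivial_of_few_const`: the total gain of `k`
blocks inserted into a longest one, of length `m`. -/
lemma gain_estimate {h q L k m : ℕ} (hL : 2 * q + 6 ≤ L + 5 * h)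
    (hq : q + 1 = 4 * h ∨ 6 * h ≤ q + 2) (hm : 2 ≤ m) (hmh : m ≤ h) (hLk : L ≤ (k + 1) * m) :
    q - 1 ≤ (L - m) + k * (m - 1) := by
  obtain ⟨m, rfl⟩ := Nat.exists_eq_add_of_le' (show 1 ≤ m by omega)
  rw [Nat.add_sub_cancel]
  rcases hq with hq | hq
  · rcases le_or_gt k 3 with hk | hk
    · interval_cases k <;> omega
    · have h1 : 4 * m ≤ k * m := Nat.mul_le_mul_right m hk
      have h2 : k ≤ k * m := Nat.le_mul_of_pos_right k (by omega)
      have h3 : (k + 1) * (m + 1) = k * m + k + m + 1 := by ring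
      omega
  · omega

namespace AffineCoords

variable {p q : ℕ} {G : Type*} [Group G] (c : AffineCoords p q G) [Fact p.Prime] [Fact q.Prime]

/-- Few elements in each class give a short product in class and position `0`. -/
lemma hasTrivial_of_few_const (hwt : Function.Injective c.wt) {S : Multiset G} {h : ℕ}
    (hp : p + 1 = 2 * h) (hq : q + 1 = 4 * h ∨ 6 * h ≤ q + 2) (hS : 2 * q + p - 1 ≤ S.card)
    (hzero : (S.filter fun a => c.cls a = 0).card ≤ p - 2)
    (hfew : ∀ i ≠ 0, (S.filter fun a => c.cls a = i).card ≤ 2 * p - 1) :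
    c.HasTrivial S q := by
  classical
  by_contra hno
  have hp2 := (Fact.out : p.Prime).two_le
  set Z := S.filter fun a => c.cls a = 0 with hZ
  set R := S.filter fun a => ¬ c.cls a = 0 with hR
  have hZR : Z + R = S := Multiset.filter_add_not _ S
  have hcard : Z.card + R.card = S.card := by rw [← hZR, Multiset.card_add]
  have hRS : R ≤ S := Multiset.filter_le _ _
  have hR0 : ∀ a ∈ R, c.cls a ≠ 0 := fun a ha => (Multiset.mem_filter.1 ha).2
  obtain ⟨Ts, h1, h2, h3⟩ := c.exists_blocks (R := R) (r := 5 * h - 4) (h := h)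
    fun R' hR' hc => by
      have h0 : (0 : ZMod p) ∉ R'.map c.cls := by
        intro h0
        obtain ⟨a, ha, ha0⟩ := Multiset.mem_map.1 h0
        exact hR0 a (Multiset.mem_of_le hR' ha) ha0
      have hcount : ∀ i, (R'.map c.cls).count i ≤ 4 * h - 3 := by
        intro i
        by_cases hi : i = 0
        · rw [hi, Multiset.count_eq_zero.2 h0]
          exact Nat.zero_le _
        · have h5 := hfew i hi
          have h6 := Multiset.count_le_of_le i (Multiset.map_le_map (f := c.cls) (hR'.trans hRS))
          have h7 : (S.map c.cls).count i = (S.filter fun a => c.cls a = i).card := by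
            rw [Multiset.count_map]
            simp only [eq_comm]
          omega
      obtain ⟨C, hC, hC0, hCc, hCs⟩ := ZMod.exists_truncated_zero_sum h0
        (ZMod.le_sum_min_count hp hcount (by simpa using hc))
      obtain ⟨T, hT, rfl⟩ := Multiset.exists_le_map_eq hC
      refine c.exists_block_of_zero_sum
        (fun h => hno (h.mono (hR'.trans hRS) (by omega))) hT ?_ hCs (by simpa using hCc)
      rintro rfl
      simp at hC0
  have hlen2 : ∀ T ∈ Ts, 2 ≤ T.length := by
    intro T hT
    have hB := (h1 T hT).1
    obtain _ | ⟨a, _ | ⟨b, T⟩⟩ := T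
    · exact absurd rfl hB.ne_nil
    · refine absurd (by simpa using hB.cls_eq) (hR0 a (Multiset.mem_of_le h2 ?_))
      exact List.mem_flatten.2 ⟨_, hT, by simp⟩
    · simp
  have hTs0 : Ts ≠ [] := by
    rintro rfl
    simp at h3
    omega
  obtain ⟨K, hK, hmax⟩ := Ts.toFinset.exists_max_image List.length
    (by simpa [Finset.nonempty_iff_ne_empty] using hTs0)
  simp only [List.mem_toFinset] at hK hmax
  have hperm : Ts.Perm (K :: Ts.erase K) := List.perm_cons_erase hK
  set Us := Ts.erase K with hUs
  have hUT : ∀ T ∈ Us, T ∈ Ts := fun T hT => List.mem_of_mem_erase hT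
  have hLU : Ts.flatten.length = K.length + Us.flatten.length := by
    simpa using hperm.flatten.length_eq
  have hgain : ∀ Vs : List (List G),
      (Vs.map fun T => K.length - 1 + T.length).sum =
        Vs.flatten.length + Vs.length * (K.length - 1) := by
    intro Vs
    simp only [List.sum_map_add, List.length_flatten, List.map_const', List.sum_replicate,
      smul_eq_mul]
    ring
  have hUK : Us.flatten.length ≤ Us.length * K.length := by
    rw [List.length_flatten]
    simpa using List.sum_le_card_nsmul (Us.map List.length) K.length
      (by simpa using fun T hT => hmax T (hUT T hT))
  have hK2 := hlen2 K hK
  have hKh := (h1 K hK).2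
  have htot : q - 1 ≤ (Us.map fun T => K.length - 1 + T.length).sum := by
    rw [hgain]
    have := gain_estimate (h := h) (q := q) (L := Ts.flatten.length) (k := Us.length) (by omega) hq
      hK2 hKh (by rw [add_mul]; omega)
    omega
  obtain ⟨Vs, hVs, hVa, hVb⟩ := List.exists_sublist_le_sum _ Us _ htot
  have hshort : K.length + Vs.flatten.length ≤ q := by
    rcases hVb with rfl | ⟨Ws, T, rfl, hW⟩
    · simp
      omega
    · have hWlen : ∀ V ∈ Ws ++ [T], V.length ≤ K.length :=
        fun V hV => hmax V (hUT V (hVs.subset hV))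
      have hT := hWlen T (by simp)
      rw [hgain] at hW
      simp only [List.flatten_append, List.flatten_singleton, List.length_append]
      rcases le_or_gt 2 Ws.length with hW2 | hW2
      · have := Nat.mul_le_mul_right (K.length - 1) hW2
        omega
      · have hWK : Ws.flatten.length ≤ K.length := by
          obtain _ | ⟨V, _ | ⟨V', Ws⟩⟩ := Ws
          · simp
          · simpa using hWlen V (by simp)
          · simp at hW2
        omega
  have hreach : c.Reach K K.length (c.pref K) {c.pos K.prod} := by
    intro v hv
    rw [Finset.mem_singleton] at hv
    exact ⟨K, (h1 K hK).1.ne_nil, le_rfl, le_rfl, (h1 K hK).1.cls_eq, hv.symm, subset_rfl⟩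
  obtain ⟨l, a1, a2, a3, a4⟩ := hreach.exists_trivial c hwt (Finset.singleton_nonempty _)
    ⟨0, c.zero_mem_pref K⟩ (Ts := Vs) (fun T hT => (h1 T (hUT T (hVs.subset hT))).1) (by
      have : (Vs.map fun T => K.length - 1 + T.length).sum ≤
          (Vs.map fun T => min p ((c.pref K).card + T.length - 1)).sum := by
        refine List.sum_le_sum fun T hT => ?_
        have b1 := (h1 K hK).1.length_le
        have b2 := (h1 T (hUT T (hVs.subset hT))).2
        omega
      rw [Finset.card_singleton]
      omega)
  refine hno ⟨l, a1, a2.trans (le_trans ?_ (h2.trans hRS)), a3.trans hshort, a4⟩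
  rw [Multiset.coe_add, ← List.flatten_cons, Multiset.coe_eq_coe.2 hperm.flatten]
  exact Multiset.coe_le.2 (hVs.cons_cons K).flatten.subperm

/-- Among `2 q + p - 1` elements there are at most `q` whose product, in some order, has class and
position `0`. -/
lemma short_hasTrivial_of_injective (hwt : Function.Injective c.wt) (hpq : p ∣ q - 1)
    {S : Multiset G} (hS : 2 * q + p - 1 ≤ S.card) : c.HasTrivial S q := by
  classical
  have hp := (Fact.out : p.Prime).two_le
  have hq := (Fact.out : q.Prime).two_le
  have hle : p + 1 ≤ q := by
    have := Nat.le_of_dvd (by omega) hpq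
    omega
  rcases le_or_gt (p - 1) (S.filter fun a => c.cls a = 0).card with hz | hz
  · exact c.hasTrivial_of_many_zero hwt (by omega) hS hz
  by_cases hmany : ∃ i ≠ 0, 2 * p ≤ (S.filter fun a => c.cls a = i).card
  · obtain ⟨i, hi, hm⟩ := hmany
    exact c.hasTrivial_of_many_const hwt hpq hS hi hm
  push Not at hmany
  rcases (Fact.out : p.Prime).eq_two_or_odd with rfl | hodd
  · exfalso
    have hsum : ∑ i, (S.map c.cls).count i = (S.map c.cls).card :=
      Multiset.sum_count_eq_card fun _ _ => Finset.mem_univ _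
    have hcount : ∀ i, (S.map c.cls).count i = (S.filter fun a => c.cls a = i).card := fun i => by
      rw [Multiset.count_map]
      simp only [eq_comm]
    have h1 := hmany 1 one_ne_zero
    have huniv : ∑ i, (S.map c.cls).count i = (S.map c.cls).count 0 + (S.map c.cls).count 1 :=
      Fin.sum_univ_two _
    rw [huniv, hcount, hcount, Multiset.card_map] at hsum
    omega
  · refine c.hasTrivial_of_few_const hwt (h := (p + 1) / 2) (by omega) ?_ hS (by omega)
      fun i hi => Nat.le_sub_one_of_lt (hmany i hi)
    obtain ⟨J, hJ⟩ := hpq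
    have hqodd : q % 2 = 1 := (Fact.out : q.Prime).eq_two_or_odd.resolve_left (by omega)
    obtain _ | _ | _ | J := J
    · omega
    · omega
    · left
      omega
    · right
      have : p * (J + 1 + 1 + 1) = p * J + 3 * p := by ring
      omega

end AffineCoords

namespace AffineCoords

variable {p q : ℕ} {G : Type*} [Group G]

section Additive

variable [Fact p.Prime] (c : AffineCoords p p G)

lemma pos_prod_of_wt_eq_one (hwt : ∀ s, c.wt s = 1) (l : List G) :
    c.pos l.prod = (l.map c.pos).sum := by
  induction l with
  | nil => simp [c.pos_one]
  | cons a l ih => simp [c.pos_mul, hwt, ih]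

lemma hasTrivial_of_zero_sum (hwt : ∀ s, c.wt s = 1) {S T : Multiset G} (hT : T ≤ S) (hT0 : T ≠ 0)
    (hz : ∀ i, (T.map fun s => ![c.cls s, c.pos s] i).sum = 0) : c.HasTrivial S T.card := by
  induction T using Quotient.inductionOn with
  | h l =>
    refine ⟨l, by simpa using hT0, hT, le_rfl, ?_, ?_⟩
    · rw [c.cls_prod]
      simpa using hz 0
    · rw [c.pos_prod_of_wt_eq_one hwt]
      simpa using hz 1

lemma hasTrivial_of_wt_eq_one (hwt : ∀ s, c.wt s = 1) {S : Multiset G}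
    (hS : p + p - 1 ≤ S.card) : c.HasTrivial S S.card := by
  have hp := (Fact.out : p.Prime).pos
  obtain ⟨T, hT, hT0, hz⟩ := ZMod.exists_zero_sum_le (fun s => ![c.cls s, c.pos s]) S (by omega)
  exact (c.hasTrivial_of_zero_sum hwt hT hT0 hz).mono le_rfl (Multiset.card_le_card hT)

lemma short_hasTrivial_of_wt_eq_one (hwt : ∀ s, c.wt s = 1) {S : Multiset G}
    (hS : 2 * p + p - 1 ≤ S.card) : c.HasTrivial S p := by
  obtain ⟨T, hT, hT0, hTc, hz⟩ :=
    ZMod.exists_short_zero_sum_le (fun s => ![c.cls s, c.pos s]) S (by omega)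
  exact (c.hasTrivial_of_zero_sum hwt hT hT0 hz).mono le_rfl hTc

end Additive

variable (c : AffineCoords p q G)

lemma exists_disjoint_trivial
    (hlong : ∀ S : Multiset G, q + p - 1 ≤ S.card → c.HasTrivial S S.card)
    (hshort : ∀ S : Multiset G, 2 * q + p - 1 ≤ S.card → c.HasTrivial S q)
    (j : ℕ) {S : Multiset G} (hS : q * j + p - 1 ≤ S.card) :
    ∃ Ts : List (List G), Ts.length = j ∧
      (∀ T ∈ Ts, T ≠ [] ∧ c.cls T.prod = 0 ∧ c.pos T.prod = 0) ∧
      (Ts.flatten : Multiset G) ≤ S := by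
  classical
  induction j generalizing S with
  | zero => exact ⟨[], by simp⟩
  | succ j ih =>
    obtain rfl | hj := Nat.eq_zero_or_pos j
    · obtain ⟨l, h1, h2, -, h3⟩ := hlong S (by simpa using hS)
      exact ⟨[l], by simp, by simpa using ⟨h1, h3⟩, by simpa using h2⟩
    · have hqj : q ≤ q * j := Nat.le_mul_of_pos_right q hj
      rw [mul_add_one] at hS
      obtain ⟨l, h1, h2, h3, h4⟩ := hshort S (by omega)
      have hc := Multiset.card_sub h2
      rw [Multiset.coe_card] at hc
      obtain ⟨Ts, e1, e2, e3⟩ := ih (S := S - l) (by omega)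
      refine ⟨l :: Ts, by simp [e1], ?_, ?_⟩
      · intro T hT
        rcases List.mem_cons.1 hT with rfl | hT
        · exact ⟨h1, h4⟩
        · exact e2 T hT
      · rw [List.flatten_cons, ← Multiset.coe_add, add_comm]
        have := add_le_add e3 (le_refl (l : Multiset G))
        rwa [Multiset.sub_add_cancel h2] at this

end AffineCoords

/-- Lists with products in a subgroup of order `m` combine, `m` at a time, into lists with
trivial product. -/
lemma exists_disjoint_prod_one {G : Type*} [Group G] [Finite G] (H : Subgroup G) (k : ℕ)
    {Ts : List (List G)} (hTs : ∀ T ∈ Ts, T ≠ [] ∧ T.prod ∈ H)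
    (hlen : Nat.card H * k ≤ Ts.length) :
    ∃ Us : List (List G), Us.length = k ∧ (∀ U ∈ Us, U ≠ [] ∧ IsProdOne U) ∧
      (Us.flatten : Multiset G) ≤ (Ts.flatten : Multiset G) := by
  classical
  induction k generalizing Ts with
  | zero => exact ⟨[], by simp⟩
  | succ k ih =>
    rw [mul_add_one] at hlen
    let f : List G → H := fun T => if h : T.prod ∈ H then ⟨T.prod, h⟩ else 1
    obtain ⟨u, v, w, rfl, hv, hvl, hvf⟩ := exists_segment_prod_eq_one f Ts (by omega)
    simp only [List.length_append] at hlen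
    obtain ⟨Us, h1, h2, h3⟩ := ih (Ts := u ++ w) (fun T hT => hTs T (by
      simp only [List.mem_append] at hT ⊢
      tauto)) (by
      rw [List.length_append]
      omega)
    have hprod : v.flatten.prod = 1 := by
      have h4 : ((v.map f).prod : G) = v.flatten.prod := by
        rw [List.prod_flatten, ← Subgroup.coe_subtype, map_list_prod, List.map_map]
        congr 1
        refine List.map_congr_left fun T hT => ?_
        simp [f, (hTs T (by simp [hT])).2]
      rw [← h4, hvf, Subgroup.coe_one]
    refine ⟨v.flatten :: Us, by simp [h1], ?_, ?_⟩
    · intro U hU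
      rcases List.mem_cons.1 hU with rfl | hU
      · refine ⟨fun h => ?_, v.flatten, List.Perm.refl _, hprod⟩
        obtain ⟨T, hT⟩ := List.exists_mem_of_ne_nil v hv
        exact (hTs T (by simp [hT])).1 (List.flatten_eq_nil_iff.1 h T hT)
      · exact h2 U hU
    · simp only [List.flatten_append, List.flatten_cons, ← Multiset.coe_add] at h3 ⊢
      calc (v.flatten : Multiset G) + Us.flatten
          ≤ (v.flatten : Multiset G) + (u.flatten + w.flatten) := add_le_add le_rfl h3
        _ = _ := by abel

section Metacyclic

variable {p n g : ℕ} {G : Type*} [Group G] {x y : G}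

lemma pow_mul_pow_of_rel (hrel : x ^ g * y = y * x) (i b : ℕ) :
    y ^ i * x ^ b = x ^ (g ^ i * b) * y ^ i := by
  have h1 : ∀ b, y * x ^ b = x ^ (g * b) * y := fun b => by
    have : SemiconjBy y x (x ^ g) := hrel.symm
    rw [pow_mul]
    exact this.pow_right b
  induction i generalizing b with
  | zero => simp
  | succ i ih =>
    rw [pow_succ, mul_assoc, h1, ← mul_assoc, ih, mul_assoc, ← pow_succ]
    congr 2
    ring

lemma normal_form_mul (hrel : x ^ g * y = y * x) (b i b' i' : ℕ) :
    x ^ b * y ^ i * (x ^ b' * y ^ i') = x ^ (b + g ^ i * b') * y ^ (i + i') := by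
  rw [mul_assoc, ← mul_assoc (y ^ i), pow_mul_pow_of_rel hrel, pow_add, pow_add]
  group

lemma exists_normal_form [Finite G] (hrel : x ^ g * y = y * x)
    (hgen : Subgroup.closure ({x, y} : Set G) = ⊤) (a : G) :
    ∃ b i : ℕ, a = x ^ b * y ^ i := by
  let M : Submonoid G :=
    { carrier := {a | ∃ b i : ℕ, a = x ^ b * y ^ i}
      one_mem' := ⟨0, 0, by simp⟩
      mul_mem' := by
        rintro _ _ ⟨b, i, rfl⟩ ⟨b', i', rfl⟩
        exact ⟨_, _, normal_form_mul hrel b i b' i'⟩ }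
  have ha : a ∈ Subgroup.closure ({x, y} : Set G) := hgen ▸ Subgroup.mem_top a
  change a ∈ M
  induction ha using Subgroup.closure_induction with
  | mem a ha =>
    rcases ha with rfl | rfl
    · exact ⟨1, 0, by simp⟩
    · exact ⟨0, 1, by simp⟩
  | one => exact M.one_mem
  | mul a b _ _ ha hb => exact M.mul_mem ha hb
  | inv a _ ha =>
    have : a⁻¹ = a ^ (orderOf a - 1) := by
      rw [inv_eq_iff_mul_eq_one, ← pow_succ', Nat.sub_add_cancel (orderOf_pos a),
        pow_orderOf_eq_one]
    rw [this]
    exact M.pow_mem ha _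

lemma normal_form_unique (hp : p.Prime) (hg : orderOf (g : ZMod n) = p)
    (hordx : orderOf x = n) (hordy : orderOf y = p) (hrel : x ^ g * y = y * x) {b i b' i' : ℕ}
    (h : x ^ b * y ^ i = x ^ b' * y ^ i') : b ≡ b' [MOD n] ∧ i ≡ i' [MOD p] := by
  have hi : i ≡ i' [MOD p] := by
    by_contra hne
    have h1 : y ^ ((i : ℤ) - i') = x ^ ((b' : ℤ) - b) := by
      rw [zpow_sub, zpow_sub, zpow_natCast, zpow_natCast, zpow_natCast, zpow_natCast,
        mul_inv_eq_iff_eq_mul, ((Commute.refl x).pow_pow _ _).inv_right.eq, mul_assoc, ← h,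
        inv_mul_cancel_left]
    have hcop : IsCoprime ((i : ℤ) - i') p := by
      rw [isCoprime_comm, (Nat.prime_iff_prime_int.mp hp).coprime_iff_not_dvd]
      exact fun hd => hne (Nat.modEq_iff_dvd.2 hd).symm
    obtain ⟨r, s, hrs⟩ := hcop
    have hy : y = x ^ (((b' : ℤ) - b) * r) := by
      have hyp : y ^ p = 1 := hordy ▸ pow_orderOf_eq_one y
      rw [zpow_mul, ← h1, ← zpow_mul]
      conv_lhs => rw [← zpow_one y, ← hrs, zpow_add, mul_comm r, mul_comm s, zpow_mul y p,
        zpow_natCast, hyp, one_zpow, mul_one]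
    have hcomm : Commute x y := by
      rw [hy]
      exact (Commute.refl x).zpow_right _
    have hxg : x ^ g = x ^ 1 := by
      rw [pow_one]
      exact mul_right_cancel (hrel.trans hcomm.eq.symm)
    rw [pow_eq_pow_iff_modEq, hordx, ← ZMod.natCast_eq_natCast_iff, Nat.cast_one] at hxg
    rw [hxg, orderOf_one] at hg
    exact hp.one_lt.ne hg
  refine ⟨?_, hi⟩
  have hy : y ^ i = y ^ i' := by rwa [pow_eq_pow_iff_modEq, hordy]
  rw [hy, mul_left_inj, pow_eq_pow_iff_modEq, hordx] at h
  exact h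

end Metacyclic

section Metacyclic

variable {p n g : ℕ} {G : Type*} [Group G] {x y : G}

/-- The coordinates `x ^ b * y ^ i ↦ (i, b mod q)` for `q ∣ n`. -/
lemma exists_affineCoords [Finite G] (hp : p.Prime) (hg : orderOf (g : ZMod n) = p)
    (hordx : orderOf x = n) (hordy : orderOf y = p) (hrel : x ^ g * y = y * x)
    (hgen : Subgroup.closure ({x, y} : Set G) = ⊤) {q : ℕ} (hq : q ∣ n) :
    ∃ c : AffineCoords p q G, (∀ s, c.wt s = (g : ZMod q) ^ s.val) ∧
      (∀ a, c.cls a = 0 → c.pos a = 0 → a ∈ Subgroup.zpowers (x ^ q)) ∧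
      c.cls x = 0 ∧ c.cls y = 1 := by
  have : Fact p.Prime := ⟨hp⟩
  choose b i hbi using exists_normal_form hrel hgen
  have huniq : ∀ (a : G) (b' i' : ℕ), a = x ^ b' * y ^ i' →
      (b a : ZMod q) = b' ∧ (i a : ZMod p) = i' := by
    intro a b' i' ha
    obtain ⟨h1, h2⟩ := normal_form_unique hp hg hordx hordy hrel ((hbi a).symm.trans ha)
    exact ⟨(ZMod.natCast_eq_natCast_iff _ _ _).2 (h1.of_dvd hq),
      (ZMod.natCast_eq_natCast_iff _ _ _).2 h2⟩
  have hgp : (g : ZMod q) ^ p = 1 := by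
    have h1 : (g : ZMod n) ^ p = 1 := hg ▸ pow_orderOf_eq_one _
    have h2 := congrArg (ZMod.castHom hq (ZMod q)) h1
    rwa [map_pow, map_natCast, map_one] at h2
  have hmod : ∀ j, (g : ZMod q) ^ (j % p) = (g : ZMod q) ^ j := fun j => by
    conv_rhs => rw [← Nat.mod_add_div j p, pow_add, pow_mul, hgp, one_pow, mul_one]
  refine ⟨⟨fun a => i a, fun a => b a, fun s => (g : ZMod q) ^ s.val, ?_, ?_, ?_, ?_⟩, fun _ => rfl,
    ?_, ?_, ?_⟩
  · intro a a'
    have h1 := huniq (a * a') _ _ (by conv_lhs => rw [hbi a, hbi a', normal_form_mul hrel])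
    rw [h1.2, Nat.cast_add]
  · intro a a'
    have h1 := huniq (a * a') _ _ (by conv_lhs => rw [hbi a, hbi a', normal_form_mul hrel])
    rw [h1.1, ZMod.val_natCast, hmod]
    push_cast
    rfl
  · simp
  · intro s t
    rw [ZMod.val_add, hmod, pow_add]
  · intro a h1 h2
    rw [ZMod.natCast_eq_zero_iff] at h1 h2
    obtain ⟨j, hj⟩ := h2
    obtain ⟨l, hl⟩ := h1
    refine ⟨j, ?_⟩
    have hyp : y ^ p = 1 := hordy ▸ pow_orderOf_eq_one y
    simp only [zpow_natCast]
    rw [← pow_mul, ← hj]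
    conv_rhs => rw [hbi a, hl, pow_mul, hyp, one_pow, mul_one]
  · simpa using (huniq x 1 0 (by simp)).2
  · simpa using (huniq y 0 1 (by simp)).2

/-- If `p ∤ n`, then `g` stays nontrivial modulo some prime factor of `n`. -/
lemma exists_prime_dvd_cast_ne_one (hp : p.Prime) (hg : orderOf (g : ZMod n) = p)
    (hpn : ¬ p ∣ n) : ∃ q, q.Prime ∧ q ∣ n ∧ (g : ZMod q) ≠ 1 := by
  by_contra! hall
  have hcop : Nat.Coprime (∑ j ∈ Finset.range p, g ^ j) n := by
    refine Nat.Coprime.symm (Nat.coprime_of_dvd' fun q hq hqn hqs => ?_)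
    rw [← ZMod.natCast_eq_zero_iff] at hqs
    push_cast at hqs
    rw [hall q hq hqn] at hqs
    simp only [one_pow, Finset.sum_const, Finset.card_range, nsmul_eq_mul, mul_one] at hqs
    rw [ZMod.natCast_eq_zero_iff, Nat.prime_dvd_prime_iff_eq hq hp] at hqs
    exact absurd (hqs ▸ hqn) hpn
  have hunit := (ZMod.isUnit_iff_coprime _ _).2 hcop
  have hgeom := geom_sum_mul (g : ZMod n) p
  have hgp : (g : ZMod n) ^ p = 1 := hg ▸ pow_orderOf_eq_one _
  rw [hgp, sub_self] at hgeom
  push_cast at hunit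
  rw [hunit.mul_right_eq_zero, sub_eq_zero] at hgeom
  rw [hgeom, orderOf_one] at hg
  exact hp.one_lt.ne hg

/-- There is a prime `q ∣ n` for which the induced coordinates see enough short products. -/
lemma exists_good_affineCoords [Finite G] (hp : p.Prime)
    (hg : orderOf (g : ZMod n) = p)
    (hordx : orderOf x = n) (hordy : orderOf y = p) (hrel : x ^ g * y = y * x)
    (hgen : Subgroup.closure ({x, y} : Set G) = ⊤) :
    ∃ q, q.Prime ∧ q ∣ n ∧ ∃ c : AffineCoords p q G,
      (∀ S : Multiset G, q + p - 1 ≤ S.card → c.HasTrivial S S.card) ∧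
      (∀ S : Multiset G, 2 * q + p - 1 ≤ S.card → c.HasTrivial S q) ∧
      (∀ a, c.cls a = 0 → c.pos a = 0 → a ∈ Subgroup.zpowers (x ^ q)) ∧
      c.cls x = 0 ∧ c.cls y = 1 := by
  have : Fact p.Prime := ⟨hp⟩
  have hgp : ∀ q, q ∣ n → (g : ZMod q) ^ p = 1 := fun q hq => by
    have h1 : (g : ZMod n) ^ p = 1 := hg ▸ pow_orderOf_eq_one _
    have h2 := congrArg (ZMod.castHom hq (ZMod q)) h1
    rwa [map_pow, map_natCast, map_one] at h2
  by_cases hpn : p ∣ n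
  · obtain ⟨c, hwt, hc⟩ := exists_affineCoords hp hg hordx hordy hrel hgen hpn
    have hg1 : (g : ZMod p) = 1 := by rw [← hgp p hpn, ZMod.pow_card]
    have hwt1 : ∀ s, c.wt s = 1 := fun s => by rw [hwt, hg1, one_pow]
    exact ⟨p, hp, hpn, c, fun S hS => c.hasTrivial_of_wt_eq_one hwt1 hS,
      fun S hS => c.short_hasTrivial_of_wt_eq_one hwt1 hS, hc⟩
  · obtain ⟨q, hq, hqn, hgq⟩ := exists_prime_dvd_cast_ne_one hp hg hpn
    have : Fact q.Prime := ⟨hq⟩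
    obtain ⟨c, hwt, hc⟩ := exists_affineCoords hp hg hordx hordy hrel hgen hqn
    have hord : orderOf (g : ZMod q) = p := orderOf_eq_prime (hgp q hqn) hgq
    have hg0 : (g : ZMod q) ≠ 0 := fun h => by
      have := hgp q hqn
      rw [h, zero_pow hp.ne_zero] at this
      exact zero_ne_one this
    have hinj : Function.Injective c.wt := fun s t hst => by
      rw [hwt, hwt] at hst
      refine ZMod.val_injective p (pow_injOn_Iio_orderOf (x := (g : ZMod q)) ?_ ?_ hst)
      · simpa [hord] using ZMod.val_lt s
      · simpa [hord] using ZMod.val_lt t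
    have hdvd : p ∣ q - 1 := hord ▸ ZMod.orderOf_dvd_card_sub_one hg0
    exact ⟨q, hq, hqn, c, fun S hS => c.hasTrivial_of_injective hinj hS,
      fun S hS => c.short_hasTrivial_of_injective hinj hdvd hS, hc⟩

/-- `n k - 1` copies of `x` and `p - 1` copies of `y` do not contain `k` disjoint product-one
sequences. -/
lemma not_disjoint_prod_one {q k : ℕ} (hp : p.Prime) (hnk : 0 < n * k) (hordx : orderOf x = n)
    (c : AffineCoords p q G) (hx : c.cls x = 0) (hy : c.cls y = 1) {Ts : List (List G)}
    (hlen : Ts.length = k) (hTs : ∀ T ∈ Ts, T ≠ [] ∧ IsProdOne T) :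
    ¬ (Ts.flatten : Multiset G) ≤
      Multiset.replicate (n * k - 1) x + Multiset.replicate (p - 1) y := by
  classical
  intro hle
  have : Fact p.Prime := ⟨hp⟩
  have hxy : x ≠ y := by
    rintro rfl
    exact zero_ne_one (hx.symm.trans hy)
  have hcx := Multiset.count_le_of_le x hle
  have hcy := Multiset.count_le_of_le y hle
  simp only [Multiset.count_add, Multiset.count_replicate, hxy, hxy.symm, if_true, if_false,
    add_zero, zero_add, Multiset.coe_count] at hcx hcy
  have hmem : ∀ T ∈ Ts, ∀ a ∈ T, a = x ∨ a = y := by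
    intro T hT a ha
    have := Multiset.mem_of_le hle (List.mem_flatten.2 ⟨T, hT, ha⟩ : a ∈ Ts.flatten)
    rcases Multiset.mem_add.1 this with h | h
    · exact Or.inl (Multiset.eq_of_mem_replicate h)
    · exact Or.inr (Multiset.eq_of_mem_replicate h)
  have hcls : ∀ T : List G, (∀ a ∈ T, a = x ∨ a = y) →
      (T.map c.cls).sum = (T.count y : ZMod p) := by
    intro T hT
    induction T with
    | nil => simp
    | cons a T ih =>
      rw [List.map_cons, List.sum_cons, ih fun a ha => hT a (by simp [ha]), List.count_cons]
      rcases hT a (by simp) with rfl | rfl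
      · simp [hx, hxy]
      · simp [hy, add_comm]
  have hallx : ∀ T ∈ Ts, ∀ a ∈ T, a = x := by
    intro T hT
    obtain ⟨-, l, hl, hl1⟩ := hTs T hT
    have h1 : (T.count y : ZMod p) = 0 := by
      rw [← hcls T (hmem T hT), ← (hl.map c.cls).sum_eq, ← c.cls_prod, hl1, c.cls_one]
    have h2 : T.count y ≤ Ts.flatten.count y := (List.sublist_flatten_of_mem hT).count_le y
    have h3 : T.count y = 0 := by
      rw [ZMod.natCast_eq_zero_iff] at h1
      refine Nat.eq_zero_of_dvd_of_lt h1 ?_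
      have := hp.pos
      omega
    intro a ha
    refine (hmem T hT a ha).resolve_right ?_
    rintro rfl
    exact List.count_eq_zero.1 h3 ha
  have hn : ∀ T ∈ Ts, n ≤ T.length := by
    intro T hT
    obtain ⟨hT0, l, hl, hl1⟩ := hTs T hT
    have h1 : l = List.replicate T.length x :=
      List.eq_replicate_iff.2 ⟨hl.length_eq, fun a ha => hallx T hT a (hl.subset ha)⟩
    rw [h1, List.prod_replicate] at hl1
    refine Nat.le_of_dvd (List.length_pos_of_ne_nil hT0) ?_
    rw [← hordx]
    exact orderOf_dvd_of_pow_eq_one hl1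
  have hcount : Ts.flatten.count x = Ts.flatten.length :=
    List.count_eq_length.2 fun a ha => by
      obtain ⟨T, hT, haT⟩ := List.mem_flatten.1 ha
      exact (hallx T hT a haT).symm
  have htot : k * n ≤ Ts.flatten.length := by
    rw [List.length_flatten, ← hlen]
    simpa using List.card_nsmul_le_sum (Ts.map List.length) n (by simpa using hn)
  rw [mul_comm] at htot
  omega

end Metacyclic

/-- For any prime `p`, `n > 1`, `k ≥ 1`, and nonabelian `G = Z_p ⋉ Z_n`
(with `ord_n(g) = p`), `d_k(G) = n k + p - 1`. -/
theorem dk_metacyclic (p n g k : ℕ) (hp : p.Prime) (hn : 1 < n) (hk : 0 < k)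
    (hg : orderOf (g : ZMod n) = p)
    (G : Type*) [Group G] [Finite G] (x y : G)
    (hordx : orderOf x = n) (hordy : orderOf y = p)
    (hrel : x ^ g * y = y * x)
    (hgen : Subgroup.closure ({x, y} : Set G) = ⊤) :
    dkC G k = n * k + p - 1 := by
  obtain ⟨q, hq, hqn, c, hlong, hshort, hker, hx, hy⟩ :=
    exists_good_affineCoords hp hg hordx hordy hrel hgen
  have hp1 := hp.one_lt
  have hnk : 0 < n * k := Nat.mul_pos (by omega) hk
  have hcard : Nat.card (Subgroup.zpowers (x ^ q)) = n / q := by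
    rw [Nat.card_zpowers, orderOf_pow_of_dvd hq.ne_zero (hordx ▸ hqn), hordx]
  have hmem : n * k + p - 1 ∈ {m | 0 < m ∧ ∀ S : List G, S.length = m →
      ∃ Ts : List (List G), Ts.length = k ∧ (∀ T ∈ Ts, T ≠ [] ∧ IsProdOne T) ∧
        (Ts.flatten : Multiset G) ≤ (S : Multiset G)} := by
    refine ⟨by omega, fun S hS => ?_⟩
    obtain ⟨Ts, h1, h2, h3⟩ := c.exists_disjoint_trivial hlong hshort (n / q * k) (S := S) (by
      rw [← mul_assoc, Nat.mul_div_cancel' hqn, Multiset.coe_card, hS])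
    obtain ⟨Us, e1, e2, e3⟩ := exists_disjoint_prod_one (Subgroup.zpowers (x ^ q)) k (Ts := Ts)
      (fun T hT => ⟨(h2 T hT).1, hker _ (h2 T hT).2.1 (h2 T hT).2.2⟩) (by rw [hcard, h1])
    exact ⟨Us, e1, e2, e3.trans h3⟩
  refine le_antisymm (Nat.sInf_le hmem) (le_csInf ⟨_, hmem⟩ ?_)
  rintro m ⟨-, hm⟩
  by_contra! hlt
  let F : List G := List.replicate (n * k - 1) x ++ List.replicate (p - 1) y
  obtain ⟨Ts, h1, h2, h3⟩ := hm (F.take m) (by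
    simp only [F, List.length_take, List.length_append, List.length_replicate]
    omega)
  refine not_disjoint_prod_one hp hnk hordx c hx hy h1 h2 (h3.trans ?_)
  exact Multiset.coe_le.2 (List.take_sublist m F).subperm
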